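/- Let 𝒜 : ℝ^{m×n} → ℝ^d be a linear map, b ∈ ℝ^d, λ > 0, a > 0, and 0 < μ < 1/‖𝒜‖₂². Suppose the sequence {X^k} in ℝ^{m×n} satisfies, for every k, that X^{k+1} is a global minimizer of the map X ↦ C_{λ,μ}(X, X^k). Then {X^k} is asymptotically regular: lim_{k→∞} ‖X^{k+1} − X^k‖_F² = 0. -/

import Mathlib

open Matrix
attribute [local instance] Matrix.frobeniusNormedAddCommGroup Matrix.frobeniusNormedSpace

/-- The singular values of a real `m × n` matrix `X` (in some order):
the square roots of the eigenvalues of the positive semidefinite matrix `X * Xᴴ = X * Xᵀ`. -/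
noncomputable def singVals {m n : ℕ} (X : Matrix (Fin m) (Fin n) ℝ) : Fin m → ℝ :=
  fun i => Real.sqrt ((Matrix.isHermitian_mul_conjTranspose_self X).eigenvalues i)

/-- The non-convex surrogate `P_a(X) = ∑_{i=1}^m a σ_i(X) / (a σ_i(X) + 1)`. -/
noncomputable def Pa {m n : ℕ} (a : ℝ) (X : Matrix (Fin m) (Fin n) ℝ) : ℝ :=
  ∑ i : Fin m, a * singVals X i / (a * singVals X i + 1)

/-- The objective `C_λ(X) = ‖𝒜(X) − b‖₂² + λ P_a(X)`. -/
noncomputable def Cobj {m n d : ℕ}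
    (A : Matrix (Fin m) (Fin n) ℝ →L[ℝ] EuclideanSpace ℝ (Fin d))
    (b : EuclideanSpace ℝ (Fin d)) (lam a : ℝ) (X : Matrix (Fin m) (Fin n) ℝ) : ℝ :=
  ‖A X - b‖ ^ 2 + lam * Pa a X

/-- The surrogate `C_{λ,μ}(X, Z) = μ [C_λ(X) − ‖𝒜(X) − 𝒜(Z)‖₂²] + ‖X − Z‖_F²`. -/
noncomputable def Csur {m n d : ℕ}
    (A : Matrix (Fin m) (Fin n) ℝ →L[ℝ] EuclideanSpace ℝ (Fin d))
    (b : EuclideanSpace ℝ (Fin d)) (lam a μ : ℝ) (X Z : Matrix (Fin m) (Fin n) ℝ) : ℝ :=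
  μ * (Cobj A b lam a X - ‖A X - A Z‖ ^ 2) + ‖X - Z‖ ^ 2

theorem Cobj_nonneg_aux {m n d : ℕ}
    (A : Matrix (Fin m) (Fin n) ℝ →L[ℝ] EuclideanSpace ℝ (Fin d))
    (b : EuclideanSpace ℝ (Fin d)) (lam a : ℝ) (hlam : 0 < lam) (ha : 0 < a)
    (X : Matrix (Fin m) (Fin n) ℝ) : 0 ≤ Cobj A b lam a X := by
  have h : 0 ≤ Pa a X := by
    unfold Pa
    refine Finset.sum_nonneg fun i _ => ?_
    have : 0 ≤ singVals X i := Real.sqrt_nonneg _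
    positivity
  unfold Cobj
  positivity

theorem summable_of_descent_aux (f C : ℕ → ℝ) (c : ℝ) (hc : 0 < c) (hf : ∀ k, 0 ≤ f k)
    (hC : ∀ k, 0 ≤ C k) (h : ∀ k, C (k + 1) + c * f k ≤ C k) : Summable f := by
  refine summable_of_sum_range_le (c := C 0 / c) hf fun N => ?_
  have key : C N + c * ∑ i ∈ Finset.range N, f i ≤ C 0 := by
    induction N with
    | zero => simp
    | succ k ih =>
      rw [Finset.sum_range_succ]
      linarith [h k, mul_add c (∑ i ∈ Finset.range k, f i) (f k)]
  rw [le_div_iff₀ hc]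
  linarith [hC N]

/-- If `0 < μ < 1/‖𝒜‖₂²` and for every `k` the iterate `X^{k+1}` is a global minimizer of
`X ↦ C_{λ,μ}(X, X^k)`, then `{X^k}` is asymptotically regular:
`lim_{k→∞} ‖X^{k+1} − X^k‖_F² = 0`. -/
theorem asymptotically_regular {m n d : ℕ}
    (A : Matrix (Fin m) (Fin n) ℝ →L[ℝ] EuclideanSpace ℝ (Fin d))
    (b : EuclideanSpace ℝ (Fin d)) (lam a μ : ℝ)
    (hlam : 0 < lam) (ha : 0 < a) (hμ0 : 0 < μ) (hμ : μ < 1 / (@norm _ ContinuousLinearMap.hasOpNorm A) ^ 2)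
    (Xseq : ℕ → Matrix (Fin m) (Fin n) ℝ)
    (hmin : ∀ k, ∀ X : Matrix (Fin m) (Fin n) ℝ,
      Csur A b lam a μ (Xseq (k + 1)) (Xseq k) ≤ Csur A b lam a μ X (Xseq k)) :
    Filter.Tendsto (fun k => ‖Xseq (k + 1) - Xseq k‖ ^ 2) Filter.atTop (nhds 0) := by
  have hL : 0 < (@norm _ ContinuousLinearMap.hasOpNorm A) ^ 2 := by
    rcases (sq_nonneg (@norm _ ContinuousLinearMap.hasOpNorm A)).eq_or_lt with h | h
    · rw [← h] at hμ
      simp at hμ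
      linarith
    · exact h
  have hc : 0 < 1 - μ * (@norm _ ContinuousLinearMap.hasOpNorm A) ^ 2 := by
    rw [lt_div_iff₀ hL] at hμ
    linarith
  refine (summable_of_descent_aux (fun k => ‖Xseq (k + 1) - Xseq k‖ ^ 2)
    (fun k => μ * Cobj A b lam a (Xseq k)) _ hc (fun k => sq_nonneg _)
    (fun k => mul_nonneg hμ0.le (Cobj_nonneg_aux A b lam a hlam ha _))
    (fun k => ?_)).tendsto_atTop_zero
  have h1 := hmin k (Xseq k)
  simp only [Csur, sub_self, norm_zero] at h1
  have h2 : ‖A (Xseq (k + 1)) - A (Xseq k)‖ ≤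
      (@norm _ ContinuousLinearMap.hasOpNorm A) * ‖Xseq (k + 1) - Xseq k‖ := by
    rw [← map_sub]
    exact A.le_opNorm _
  have h3 := pow_le_pow_left₀ (norm_nonneg _) h2 2
  rw [mul_pow] at h3
  have h4 := mul_le_mul_of_nonneg_left h3 hμ0.le
  linarith
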